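/- arXiv:1710.04234 — 2 statements merged into one kernel-verified Lean document; each statement's English description precedes it below -/
import Mathlib

section
/- (Lemma 1, teleportation) Let (y_1, s_1), …, (y_t, s_t) with s_i ∈ {−1, 1} and ε ≥ 0 be such that the breakpoints b_i = y_i − s_i ε are pairwise distinct, with sorted order b_{(1)} < … < b_{(t)} and conventions b_{(0)} = −∞, b_{(t+1)} = +∞. For i ∈ {1, …, t+1}, define p_{t,i}(μ) = Σ_{j=1}^t ℓ(s_j(μ − y_j) + ε) · I[(s_j = −1 and b_{(i−1)} < y_j + ε) or (s_j = 1 and y_j − ε < b_{(i)})]. Then for every i ∈ {1, …, t} and every μ ∈ ℝ, p_{t,i+1}(μ) = p_{t,i}(μ) + f_{t,i}(μ), where f_{t,i}(μ) = s_k · ℓ(s_k(μ − y_k) + ε) for the unique k ∈ {1, …, t} such that y_k − s_k ε = b_{(i)}. -/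
open scoped Classical

/-- **Lemma 1, teleportation.** With pairwise distinct breakpoints
`b_i = y_i − s_i ε` sorted as `b : Fin t → ℝ` (via a permutation `σ`), conventions
`B 0 = −∞`, `B (t+1) = +∞`, `B (i+1) = b i`, and (0-indexed) pieces
`p_i(μ) = Σ_j ℓ(s_j(μ − y_j) + ε) · I[(s_j = −1 ∧ B i < y_j + ε) ∨ (s_j = 1 ∧ y_j − ε < B (i+1))]`
for `i ∈ {0, …, t}`: for every `i ∈ {0, …, t−1}` (i.e. `i : Fin t`) and every `μ ∈ ℝ`,
`p_{i+1}(μ) = p_i(μ) + s_k · ℓ(s_k(μ − y_k) + ε)` for the (unique) `k` such that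
`y_k − s_k ε = b i`. -/
theorem piece_teleportation
    (t : ℕ) (y s : Fin t → ℝ) (ε : ℝ) (hε : 0 ≤ ε)
    (hs : ∀ i, s i = 1 ∨ s i = -1)
    (ℓ : ℝ → ℝ) (hℓ : ℓ = (fun x => x) ∨ ℓ = fun x => x ^ 2)
    (σ : Equiv.Perm (Fin t)) (b : Fin t → ℝ)
    (hb : ∀ i, b i = y (σ i) - s (σ i) * ε) (hmono : StrictMono b)
    (B : ℕ → EReal) (hB0 : B 0 = ⊥) (hBtop : B (t + 1) = ⊤)
    (hBmid : ∀ i : Fin t, B ((i : ℕ) + 1) = (b i : EReal))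
    (p : ℕ → ℝ → ℝ)
    (hp : ∀ (i : ℕ) (μ : ℝ), p i μ =
      ∑ j, ℓ (s j * (μ - y j) + ε) *
        (if (s j = -1 ∧ B i < ((y j + ε : ℝ) : EReal)) ∨
            (s j = 1 ∧ ((y j - ε : ℝ) : EReal) < B (i + 1)) then 1 else 0)) :
    ∀ (i : Fin t) (μ : ℝ) (k : Fin t), y k - s k * ε = b i →
      p ((i : ℕ) + 1) μ = p i μ + s k * ℓ (s k * (μ - y k) + ε) := by
  intro i μ k hk
  have h1 : ∀ n, n ≤ t → ∀ m : Fin t, B n < ((b m : ℝ) : EReal) ↔ n ≤ (m : ℕ) := by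
    intro n hn m
    rcases n with _ | n
    · simp [hB0, EReal.bot_lt_coe]
    · have := hBmid ⟨n, hn⟩
      simp only at this
      rw [this, EReal.coe_lt_coe_iff, hmono.lt_iff_lt, Fin.lt_def]
      simp only
      omega
  have h2 : ∀ n, n ≤ t → ∀ m : Fin t, ((b m : ℝ) : EReal) < B (n + 1) ↔ (m : ℕ) < n := by
    intro n hn m
    rcases hn.lt_or_eq with h | h
    · have := hBmid ⟨n, h⟩
      simp only at this
      rw [this, EReal.coe_lt_coe_iff, hmono.lt_iff_lt, Fin.lt_def]
    · subst h
      simp [hBtop, EReal.coe_lt_top]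
  have hki : k = σ i := by
    obtain ⟨m, rfl⟩ := σ.surjective k
    rw [← hb m] at hk
    rw [hmono.injective hk]
  have hit : (i : ℕ) < t := i.2
  have hsum : s k * ℓ (s k * (μ - y k) + ε)
      = ∑ j, if j = k then s j * ℓ (s j * (μ - y j) + ε) else 0 := by
    simp
  rw [hp, hp, hsum, ← Finset.sum_add_distrib]
  refine Finset.sum_congr rfl fun j _ => ?_
  obtain ⟨m, rfl⟩ := σ.surjective j
  have hbm := hb m
  subst hki
  simp only [σ.injective.eq_iff, Fin.ext_iff]
  rcases hs (σ m) with h | h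
  · have e : y (σ m) - ε = b m := by rw [hbm, h]; ring
    have hne : ¬ ((1 : ℝ) = -1) := by norm_num
    simp only [h, hne, false_and, false_or, true_and, e]
    simp only [h2 ((i : ℕ) + 1) (by omega) m, h2 (i : ℕ) (by omega) m]
    rcases lt_trichotomy (m : ℕ) i with h | h | h
    · simp [h, h.ne, Nat.lt_succ_of_lt h]
    · simp [h]
    · have : ¬ ((m : ℕ) < i + 1) := by omega
      have h4 : ¬ ((m : ℕ) < i) := by omega
      rw [if_neg this, if_neg h4, if_neg h.ne']; ring
  · have e : y (σ m) + ε = b m := by rw [hbm, h]; ring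
    have hne : ¬ ((-1 : ℝ) = 1) := by norm_num
    simp only [h, hne, false_and, or_false, true_and, e]
    simp only [h1 ((i : ℕ) + 1) (by omega) m, h1 (i : ℕ) (by omega) m]
    rcases lt_trichotomy (m : ℕ) i with h | h | h
    · have h3 : ¬ ((i : ℕ) + 1 ≤ m) := by omega
      have h4 : ¬ ((i : ℕ) ≤ m) := by omega
      simp [h3, h4, h.ne]
    · simp [h]
    · have h3 : ((i : ℕ) + 1 ≤ m) := by omega
      simp [h3, h.le, h.ne']
end

section
/- (Theorem 2 of the supplementary material: at most one pointer move for the linear hinge loss) Let ℓ(x) = x, ε ≥ 0, and let (y_1, s_1), …, (y_t, s_t) with s_i ∈ {−1, 1} have pairwise distinct breakpoints b_i = y_i − s_i ε. Let P_{t−1}(μ) = Σ_{i=1}^{t−1} max(0, s_i(μ − y_i) + ε) and P_t = P_{t−1} + max(0, s_t(μ − y_t) + ε). Let c_{(1)} < … < c_{(t−1)} be the sorted breakpoints of P_{t−1} (with c_{(0)} = −∞, c_{(t)} = +∞) and b_{(1)} < … < b_{(t)} those of P_t (with b_{(0)} = −∞, b_{(t+1)} = +∞). Let J_{t−1} be the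 largest index i ∈ {1, …, t} such that (c_{(i−1)}, c_{(i)}] contains a global minimizer of P_{t−1}, let j_t = J_{t−1} + 1 if b_t < c_{(J_{t−1})} and j_t = J_{t−1} otherwise, and let J_t be the largest index i ∈ {1, …, t+1} such that (b_{(i−1)}, b_{(i)}] contains a global minimizer of P_t. Then |J_t − j_t| ≤ 1. -/
/-- The rightmost minimizing piece has index the number of negative signs. -/
theorem hinge_pointer_eq (N : ℕ) (y s : Fin N → ℝ) (ε : ℝ)
    (hs : ∀ i, s i = 1 ∨ s i = -1)
    (σ : Equiv.Perm (Fin N)) (b : Fin N → ℝ)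
    (hb : ∀ i, b i = y (σ i) - s (σ i) * ε) (hbmono : StrictMono b)
    (B : ℕ → EReal) (hB0 : B 0 = ⊥) (hBtop : B (N + 1) = ⊤)
    (hBmid : ∀ i : Fin N, B ((i : ℕ) + 1) = (b i : EReal))
    (P : ℝ → ℝ) (hP : ∀ μ, P μ = ∑ i : Fin N, max (s i * (μ - y i) + ε) 0)
    (J : ℕ)
    (hJ : IsGreatest {i : ℕ | i ≤ N ∧
      ∃ μ : ℝ, B i < (μ : EReal) ∧ (μ : EReal) ≤ B (i + 1) ∧ ∀ ν, P μ ≤ P ν} J) :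
    (J : ℝ) = ∑ i : Fin N, if s i = -1 then (1 : ℝ) else 0 := by
  obtain ⟨m, hm⟩ : ∃ m : ℕ, m = (Finset.univ.filter (fun i : Fin N => s i = -1)).card := ⟨_, rfl⟩
  have hmN : m ≤ N := by
    rw [hm]; exact (Finset.card_le_univ _).trans (by simp)
  have hmsum : (∑ i : Fin N, if s i = -1 then (1 : ℝ) else 0) = m := by
    rw [hm]; simp
  rw [hmsum]
  -- the formula for P
  have hPf : ∃ K : ℝ, ∀ μ, P μ = (∑ k : Fin N, max (μ - b k) 0) - m * μ + K := by
    refine ⟨∑ k : Fin N, if s (σ k) = -1 then b k else 0, fun μ => ?_⟩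
    have h1 : (m : ℝ) * μ = ∑ k : Fin N, if s (σ k) = -1 then μ else 0 := by
      rw [Equiv.sum_comp σ (fun i => if s i = -1 then μ else 0), ← hmsum, Finset.sum_mul]
      exact Finset.sum_congr rfl fun i _ => by split_ifs <;> simp
    rw [hP, h1, ← Equiv.sum_comp σ, ← Finset.sum_sub_distrib, ← Finset.sum_add_distrib]
    refine Finset.sum_congr rfl fun k _ => ?_
    have hk := hb k
    rcases hs (σ k) with h | h
    · rw [h] at hk ⊢
      rw [if_neg (by norm_num), if_neg (by norm_num), hk]
      ring_nf
    · rw [h] at hk ⊢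
      rw [if_pos rfl, if_pos rfl, hk]
      rcases le_total (μ - y (σ k) - ε) 0 with h' | h'
      · rw [max_eq_left (by linarith), max_eq_right (by linarith)]; ring
      · rw [max_eq_right (by linarith), max_eq_left (by linarith)]; ring
  obtain ⟨K, hK⟩ := hPf
  -- linear minorants
  have hg : ∀ i : ℕ, i ≤ N → ∀ μ : ℝ, (∑ k : Fin N, if (k : ℕ) < i then μ - b k else 0)
      = i * μ - ∑ k : Fin N, if (k : ℕ) < i then b k else 0 := by
    intro i hi μ
    have h1 : (i : ℝ) * μ = ∑ k : Fin N, if (k : ℕ) < i then μ else 0 := by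
      rw [Fin.sum_univ_eq_sum_range (fun k => if k < i then μ else 0) N, ← Finset.sum_filter]
      have : (Finset.range N).filter (fun k => k < i) = Finset.range i := by
        ext k; simp; omega
      rw [this]; simp
    rw [h1, ← Finset.sum_sub_distrib]
    exact Finset.sum_congr rfl fun k _ => by split_ifs <;> simp
  have hlow : ∀ i : ℕ, ∀ μ : ℝ, (∑ k : Fin N, if (k : ℕ) < i then μ - b k else 0)
      ≤ ∑ k : Fin N, max (μ - b k) 0 := by
    intro i μ
    refine Finset.sum_le_sum fun k _ => ?_
    split_ifs
    · exact le_max_left _ _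
    · exact le_max_right _ _
  obtain ⟨D, hD⟩ : ∃ D : ℝ, D = ∑ k : Fin N, if (k : ℕ) < m then b k else 0 := ⟨_, rfl⟩
  have hPlow : ∀ ν, K - D ≤ P ν := by
    intro ν
    have := hlow m ν
    rw [hg m hmN, ← hD] at this
    rw [hK]; linarith
  -- a minimizer in piece m
  have hBlt : B m < B (m + 1) := by
    rcases Nat.eq_zero_or_pos m with h0 | h0
    · rw [h0, hB0]
      rcases Nat.eq_zero_or_pos N with hN | hN
      · subst hN; rw [hBtop]; exact bot_lt_top
      · have := hBmid ⟨0, hN⟩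
        simp only at this
        rw [this]; exact EReal.bot_lt_coe _
    · have h1 := hBmid ⟨m - 1, by omega⟩
      have e : m - 1 + 1 = m := by omega
      simp only [e] at h1
      rw [h1]
      rcases hmN.eq_or_lt with hN | hN
      · rw [show B (m + 1) = ⊤ from hN ▸ hBtop]; exact EReal.coe_lt_top _
      · have h2 := hBmid ⟨m, hN⟩
        simp only at h2
        rw [h2, EReal.coe_lt_coe_iff]
        exact hbmono (by rw [Fin.lt_def]; simp; omega)
  obtain ⟨μ₀, hμ1, hμ2⟩ := EReal.lt_iff_exists_real_btwn.1 hBlt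
  have hbelow : ∀ k : Fin N, (k : ℕ) < m → b k ≤ μ₀ := by
    intro k hk
    have h1 := hBmid ⟨m - 1, by omega⟩
    have e : m - 1 + 1 = m := by omega
    simp only [e] at h1
    rw [h1, EReal.coe_lt_coe_iff] at hμ1
    exact (hbmono.monotone (by rw [Fin.le_def]; simp; omega)).trans hμ1.le
  have habove : ∀ k : Fin N, ¬ (k : ℕ) < m → μ₀ ≤ b k := by
    intro k hk
    have h2 := hBmid ⟨m, by omega⟩
    simp only at h2
    rw [h2, EReal.coe_lt_coe_iff] at hμ2
    exact hμ2.le.trans (hbmono.monotone (by rw [Fin.le_def]; simp; omega))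
  have hPμ : P μ₀ = K - D := by
    have : (∑ k : Fin N, max (μ₀ - b k) 0) = ∑ k : Fin N, if (k : ℕ) < m then μ₀ - b k else 0 := by
      refine Finset.sum_congr rfl fun k _ => ?_
      split_ifs with h
      · exact max_eq_left (by linarith [hbelow k h])
      · exact max_eq_right (by linarith [habove k h])
    rw [hK, this, hg m hmN, ← hD]; ring
  have hge : m ≤ J := hJ.2 ⟨hmN, μ₀, hμ1, hμ2.le, fun ν => by rw [hPμ]; exact hPlow ν⟩
  have hle : J ≤ m := by
    by_contra hlt
    obtain ⟨⟨hJN, μ, h1, -, hmin⟩, -⟩ := hJ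
    have hB := hBmid ⟨J - 1, by omega⟩
    have e : J - 1 + 1 = J := by omega
    simp only [e] at hB
    rw [hB, EReal.coe_lt_coe_iff] at h1
    have hbm : b ⟨m, by omega⟩ < μ :=
      (hbmono.monotone (by rw [Fin.le_def]; simp; omega)).trans_lt h1
    have hstrict : (∑ k : Fin N, if (k : ℕ) < m then μ - b k else 0)
        < ∑ k : Fin N, max (μ - b k) 0 := by
      refine Finset.sum_lt_sum (fun k _ => ?_) ⟨⟨m, by omega⟩, Finset.mem_univ _, ?_⟩
      · split_ifs
        · exact le_max_left _ _
        · exact le_max_right _ _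
      · simp [hbm]
    rw [hg m hmN, ← hD] at hstrict
    have := hmin μ₀
    rw [hPμ, hK] at this
    linarith
  exact_mod_cast le_antisymm hle hge


/-- **Supplementary Theorem 2: at most one pointer move, linear hinge loss.**
Data `(y_i, s_i)`, `i : Fin (n+1)`, with `s_i ∈ {−1, 1}`, margin `ε ≥ 0`, and pairwise
distinct breakpoints `y_i − s_i ε`. `Pold` is the sum of the first `n` linear hinge losses
and `Pnew = Pold + max(0, s_{last}(μ − y_{last}) + ε)`. The old breakpoints, sorted, are
`c : Fin n → ℝ` (extended by `C 0 = −∞`, `C (n+1) = +∞`), the new ones are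
`b : Fin (n+1) → ℝ` (extended by `B 0 = −∞`, `B (n+2) = +∞`). `Jold` is the largest
(0-indexed) piece index `i ≤ n` such that `(C i, C (i+1)]` contains a global minimizer of
`Pold`; `jt = Jold + 1` if the new breakpoint is `< C (Jold + 1)` and `jt = Jold`
otherwise; `Jnew` is the largest piece index `i ≤ n+1` such that `(B i, B (i+1)]` contains
a global minimizer of `Pnew`. Then `|Jnew − jt| ≤ 1`. -/
theorem linear_hinge_at_most_one_pointer_move
    (n : ℕ) (y s : Fin (n + 1) → ℝ) (ε : ℝ) (hε : 0 ≤ ε)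
    (hs : ∀ i, s i = 1 ∨ s i = -1)
    (σc : Equiv.Perm (Fin n)) (c : Fin n → ℝ)
    (hc : ∀ i, c i = y (Fin.castSucc (σc i)) - s (Fin.castSucc (σc i)) * ε)
    (hcmono : StrictMono c)
    (σb : Equiv.Perm (Fin (n + 1))) (b : Fin (n + 1) → ℝ)
    (hb : ∀ i, b i = y (σb i) - s (σb i) * ε) (hbmono : StrictMono b)
    (C : ℕ → EReal) (hC0 : C 0 = ⊥) (hCtop : C (n + 1) = ⊤)
    (hCmid : ∀ i : Fin n, C ((i : ℕ) + 1) = (c i : EReal))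
    (B : ℕ → EReal) (hB0 : B 0 = ⊥) (hBtop : B (n + 2) = ⊤)
    (hBmid : ∀ i : Fin (n + 1), B ((i : ℕ) + 1) = (b i : EReal))
    (Pold Pnew : ℝ → ℝ)
    (hPold : ∀ μ, Pold μ =
      ∑ i : Fin n, max (s (Fin.castSucc i) * (μ - y (Fin.castSucc i)) + ε) 0)
    (hPnew : ∀ μ, Pnew μ = ∑ i : Fin (n + 1), max (s i * (μ - y i) + ε) 0)
    (Jold Jnew jt : ℕ)
    (hJold : IsGreatest {i : ℕ | i ≤ n ∧
      ∃ μ : ℝ, C i < (μ : EReal) ∧ (μ : EReal) ≤ C (i + 1) ∧ ∀ ν, Pold μ ≤ Pold ν} Jold)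
    (hJnew : IsGreatest {i : ℕ | i ≤ n + 1 ∧
      ∃ μ : ℝ, B i < (μ : EReal) ∧ (μ : EReal) ≤ B (i + 1) ∧ ∀ ν, Pnew μ ≤ Pnew ν} Jnew)
    (hjt1 : ((y (Fin.last n) - s (Fin.last n) * ε : ℝ) : EReal) < C (Jold + 1) →
      jt = Jold + 1)
    (hjt2 : ¬ ((y (Fin.last n) - s (Fin.last n) * ε : ℝ) : EReal) < C (Jold + 1) →
      jt = Jold) :
    Jnew ≤ jt + 1 ∧ jt ≤ Jnew + 1 := by
  have h1 := hinge_pointer_eq n (fun i => y i.castSucc) (fun i => s i.castSucc) ε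
    (fun i => hs _) σc c hc hcmono C hC0 hCtop hCmid Pold hPold Jold hJold
  have h2 := hinge_pointer_eq (n + 1) y s ε hs σb b hb hbmono B hB0 hBtop hBmid Pnew hPnew
    Jnew hJnew
  rw [Fin.sum_univ_castSucc, ← h1] at h2
  have h3 : Jnew = Jold ∨ Jnew = Jold + 1 := by
    split_ifs at h2
    · right; exact_mod_cast h2
    · left; rw [add_zero] at h2; exact_mod_cast h2
  have h4 : jt = Jold + 1 ∨ jt = Jold := by
    by_cases h : ((y (Fin.last n) - s (Fin.last n) * ε : ℝ) : EReal) < C (Jold + 1)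
    · exact Or.inl (hjt1 h)
    · exact Or.inr (hjt2 h)
  omega
end
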